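/- A map ψ : A → A^{⊗n} is a unital ring homomorphism if and only if there exist d ∈ {1, …, n}, a sign s ∈ {1, −1}, and elements f, g ∈ A^{⊗n} such that ψ is the unique ring homomorphism with ψ(t) = s·t_d + f·x_d and ψ(x) = g·x_d (and consequently ψ(t·x) = s·g·t_d·x_d). In particular, every unital ring homomorphism ψ : A → A^{⊗n} satisfies ψ(t) = s·t_d + f·x_d and ψ(x) = g·x_d for some such d, s, f, g, and conversely every such assignment of values on t and x extends to a unital ring homomorphism A → A^{⊗n}. -/

import Mathlib

open scoped TensorProduct

noncomputable section

/-- The free `ℤ`-algebra on two generators `ι 0` (playing the role of `t`)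
and `ι 1` (playing the role of `x`). -/
abbrev FreeTwo : Type := FreeAlgebra ℤ (Fin 2)

/-- The relations `t² = q`, `t·x = −x·t`, `x² = 0`. -/
inductive ARel (q : ℕ) : FreeTwo → FreeTwo → Prop
  | t_sq : ARel q (FreeAlgebra.ι ℤ (0 : Fin 2) * FreeAlgebra.ι ℤ (0 : Fin 2)) (q : FreeTwo)
  | t_x : ARel q (FreeAlgebra.ι ℤ (0 : Fin 2) * FreeAlgebra.ι ℤ (1 : Fin 2))
      (-(FreeAlgebra.ι ℤ (1 : Fin 2) * FreeAlgebra.ι ℤ (0 : Fin 2)))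
  | x_sq : ARel q (FreeAlgebra.ι ℤ (1 : Fin 2) * FreeAlgebra.ι ℤ (1 : Fin 2)) 0

/-- The ring `A`: the quotient of the free `ℤ`-algebra on `t, x` by the two-sided
ideal generated by `t² − q`, `t·x + x·t`, `x²`. -/
abbrev A (q : ℕ) : Type := RingQuot (ARel q)

/-- The generator `t` of `A`. -/
def tA (q : ℕ) : A q := RingQuot.mkRingHom (ARel q) (FreeAlgebra.ι ℤ (0 : Fin 2))

/-- The generator `x` of `A`. -/
def xA (q : ℕ) : A q := RingQuot.mkRingHom (ARel q) (FreeAlgebra.ι ℤ (1 : Fin 2))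

/-- The `n`-fold tensor power `A^{⊗ n}` over `ℤ`, a ring with componentwise
multiplication. -/
abbrev Tpow (q n : ℕ) : Type := ⨂[ℤ] (_ : Fin n), A q

/-- `t_i ∈ A^{⊗ n}`, the image of `t` under the `i`-th inclusion `A → A^{⊗ n}`. -/
def tI (q n : ℕ) (i : Fin n) : Tpow q n :=
  PiTensorProduct.tprod ℤ (fun j => if j = i then tA q else 1)

/-- `x_i ∈ A^{⊗ n}`, the image of `x` under the `i`-th inclusion `A → A^{⊗ n}`. -/
def xI (q n : ℕ) (i : Fin n) : Tpow q n :=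
  PiTensorProduct.tprod ℤ (fun j => if j = i then xA q else 1)

section Algebra

/-- The ring `A` behind a definition, so that its ring structure is found along one path only. -/
def AlgA (q : ℕ) : Type := A q

instance (q : ℕ) : Ring (AlgA q) := inferInstanceAs (Ring (A q))

/-- The projection from the free algebra. -/
def mkAlgA (q : ℕ) : FreeTwo →+* AlgA q := RingQuot.mkRingHom (ARel q)

/-- The generator `t`. -/
def genT (q : ℕ) : AlgA q := mkAlgA q (FreeAlgebra.ι ℤ 0)

/-- The generator `x`. -/
def genX (q : ℕ) : AlgA q := mkAlgA q (FreeAlgebra.ι ℤ 1)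

variable {q : ℕ}

lemma mkAlgA_surjective : Function.Surjective (mkAlgA q) := RingQuot.mkRingHom_surjective _

lemma mkAlgA_rel {a b : FreeTwo} (h : ARel q a b) : mkAlgA q a = mkAlgA q b :=
  RingQuot.mkRingHom_rel h

variable (q)

lemma genT_mul_genT : genT q * genT q = (q : AlgA q) := by
  simpa [genT, genX] using mkAlgA_rel (ARel.t_sq (q := q))

lemma genT_mul_genX : genT q * genX q = -(genX q * genT q) := by
  simpa [genT, genX] using mkAlgA_rel (ARel.t_x (q := q))

lemma genX_mul_genX : genX q * genX q = 0 := by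
  simpa [genT, genX] using mkAlgA_rel (ARel.x_sq (q := q))

variable {q}

/-- The universal property of `A`. -/
def liftAlgA {S : Type*} [Ring S] (t x : S) (htt : t * t = q) (htx : t * x = -(x * t))
    (hxx : x * x = 0) : AlgA q →+* S :=
  RingQuot.lift ⟨(FreeAlgebra.lift ℤ ![t, x]).toRingHom, by
    rintro _ _ (_ | _ | _) <;> simp [htt, htx, hxx]⟩

section

variable {S : Type*} [Ring S] (t x : S) (htt : t * t = q) (htx : t * x = -(x * t))
    (hxx : x * x = 0)

@[simp]
lemma liftAlgA_genT : liftAlgA t x htt htx hxx (genT q) = t :=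
  (RingQuot.lift_mkRingHom_apply _ _ _).trans (by simp)

@[simp]
lemma liftAlgA_genX : liftAlgA t x htt htx hxx (genX q) = x :=
  (RingQuot.lift_mkRingHom_apply _ _ _).trans (by simp)

end

lemma AlgA_induction {P : AlgA q → Prop} (hint : ∀ m : ℤ, P m) (ht : P (genT q)) (hx : P (genX q))
    (hadd : ∀ a b, P a → P b → P (a + b)) (hmul : ∀ a b, P a → P b → P (a * b)) (a : AlgA q) :
    P a := by
  obtain ⟨a, rfl⟩ := mkAlgA_surjective a
  induction a using FreeAlgebra.induction with
  | grade0 m => simpa using hint m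
  | grade1 i => fin_cases i; exacts [ht, hx]
  | mul a b ha hb => simpa using hmul _ _ ha hb
  | add a b ha hb => simpa using hadd _ _ ha hb

lemma AlgA_hom_ext {S : Type*} [Ring S] {f g : AlgA q →+* S} (ht : f (genT q) = g (genT q))
    (hx : f (genX q) = g (genX q)) : f = g := by
  refine RingHom.ext fun a : AlgA q ↦ ?_
  induction a using AlgA_induction with
  | hint m => simp
  | ht => exact ht
  | hx => exact hx
  | hadd a b ha hb => simp [ha, hb]
  | hmul a b ha hb => simp [ha, hb]

variable (q)

/-- The left regular representation of `A` in the basis `1, t, x, t·x`. -/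
def regRep : AlgA q →+* Matrix (Fin 4) (Fin 4) ℤ :=
  liftAlgA !![0, (q : ℤ), 0, 0; 1, 0, 0, 0; 0, 0, 0, (q : ℤ); 0, 0, 1, 0]
    !![0, 0, 0, 0; 0, 0, 0, 0; 1, 0, 0, 0; 0, -1, 0, 0]
    (by ext i j; rw [← Matrix.diagonal_natCast]
        fin_cases i <;> fin_cases j <;> simp [Matrix.mul_apply, Fin.sum_univ_four])
    (by ext i j; fin_cases i <;> fin_cases j <;> simp [Matrix.mul_apply, Fin.sum_univ_four])
    (by ext i j; fin_cases i <;> fin_cases j <;> simp [Matrix.mul_apply, Fin.sum_univ_four])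

/-- The element of `A` with given coordinates with respect to `1, t, x, t·x`. -/
def ofCoords : (Fin 4 → ℤ) →ₗ[ℤ] AlgA q :=
  Fintype.linearCombination ℤ ![1, genT q, genX q, genT q * genX q]

lemma ofCoords_apply (v : Fin 4 → ℤ) :
    ofCoords q v = v 0 • 1 + v 1 • genT q + v 2 • genX q + v 3 • (genT q * genX q) := by
  simp [ofCoords, Fintype.linearCombination_apply, Fin.sum_univ_four]

lemma regRep_genT_mulVec (v : Fin 4 → ℤ) :
    (regRep q (genT q)).mulVec v = ![q * v 1, v 0, q * v 3, v 2] := by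
  ext i
  fin_cases i <;> simp [regRep, Matrix.mulVec, dotProduct, Fin.sum_univ_four]

lemma regRep_genX_mulVec (v : Fin 4 → ℤ) :
    (regRep q (genX q)).mulVec v = ![0, 0, v 0, -v 1] := by
  ext i
  fin_cases i <;> simp [regRep, Matrix.mulVec, dotProduct, Fin.sum_univ_four]

lemma genT_mul_genT_mul (a : AlgA q) : genT q * (genT q * a) = (q : ℤ) • a := by
  rw [← mul_assoc, genT_mul_genT, ← Int.cast_natCast, zsmul_eq_mul]

lemma genX_mul_genT : genX q * genT q = -(genT q * genX q) := by
  rw [genT_mul_genX, neg_neg]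

lemma genX_mul_genT_mul (a : AlgA q) : genX q * (genT q * a) = -(genT q * (genX q * a)) := by
  rw [← mul_assoc, genX_mul_genT, neg_mul, mul_assoc]

variable {q} in
lemma ofCoords_regRep_mulVec (a : AlgA q) (v : Fin 4 → ℤ) :
    ofCoords q ((regRep q a).mulVec v) = a * ofCoords q v := by
  induction a using AlgA_induction generalizing v with
  | hint m => rw [map_intCast, ← zsmul_one, Matrix.smul_mulVec, Matrix.one_mulVec, map_zsmul,
      zsmul_eq_mul]
  | ht =>
    have := genT_mul_genT_mul q 1
    rw [mul_one] at this
    simp only [regRep_genT_mulVec, ofCoords_apply, mul_add, mul_smul_comm, genT_mul_genT_mul, this,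
      mul_one]
    simp [-zsmul_eq_mul, -zsmul_one, -natCast_zsmul]
    module
  | hx =>
    simp [-zsmul_eq_mul, -zsmul_one, regRep_genX_mulVec, ofCoords_apply, mul_add, genX_mul_genT,
      genX_mul_genT_mul,
      genX_mul_genX]
  | hadd a b ha hb => rw [map_add, Matrix.add_mulVec, map_add, ha, hb, add_mul]
  | hmul a b ha hb => rw [map_mul, ← Matrix.mulVec_mulVec, ha, hb, mul_assoc]

/-- `A` is free over `ℤ` with basis `1, t, x, t·x`. -/
def basisA : Module.Basis (Fin 4) ℤ (AlgA q) :=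
  .ofEquivFun <| .symm <| .ofBijective (ofCoords q) <| by
    have key : Function.LeftInverse (fun a ↦ (regRep q a).mulVec ![1, 0, 0, 0]) (ofCoords q) := by
      intro v
      simp only [ofCoords_apply, map_add, map_mul, map_zsmul, map_one, Matrix.add_mulVec,
        ← Matrix.mulVec_mulVec, Matrix.smul_mulVec, regRep_genT_mulVec, regRep_genX_mulVec]
      ext i
      fin_cases i <;> simp
    refine ⟨key.injective, fun a ↦ ⟨(regRep q a).mulVec ![1, 0, 0, 0], ?_⟩⟩
    rw [ofCoords_regRep_mulVec]
    simp [ofCoords_apply]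

lemma basisA_apply (i : Fin 4) : basisA q i = ![1, genT q, genX q, genT q * genX q] i := by
  simp [basisA, ofCoords]

variable {q}

lemma exists_coords (a : AlgA q) : ∃ k l m n : ℤ,
    a = k • 1 + l • genT q + m • genX q + n • (genT q * genX q) := by
  obtain ⟨v, rfl⟩ := (basisA q).equivFun.symm.surjective a
  exact ⟨v 0, v 1, v 2, v 3, ofCoords_apply q v⟩

lemma genX_mul_mul_genX (a : AlgA q) : genX q * a * genX q = 0 := by
  obtain ⟨k, l, m, n, rfl⟩ := exists_coords a
  simp [-zsmul_eq_mul, -zsmul_one, mul_add, add_mul, mul_assoc, genX_mul_genT_mul, genX_mul_genX]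

lemma genT_mul_mul_genX (a : AlgA q) : genT q * a * genX q = a * genT q * genX q := by
  obtain ⟨k, l, m, n, rfl⟩ := exists_coords a
  simp [-zsmul_eq_mul, -zsmul_one, mul_add, add_mul, mul_assoc, genX_mul_genT_mul, genX_mul_genX]

variable (q) in
/-- The endomorphism of `A` fixing `t` and killing `x`. -/
def killX : AlgA q →+* AlgA q :=
  liftAlgA (genT q) 0 (genT_mul_genT q) (by simp) (by simp)

@[simp]
lemma killX_genT : killX q (genT q) = genT q := by simp [killX]

@[simp]
lemma killX_genX : killX q (genX q) = 0 := by simp [killX]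

lemma commute_genT_killX (a : AlgA q) : Commute (genT q) (killX q a) := by
  induction a using AlgA_induction with
  | hint m => simp
  | ht => simp
  | hx => simp
  | hadd a b ha hb => simpa using ha.add_right hb
  | hmul a b ha hb => simpa using ha.mul_right hb

lemma exists_eq_killX_add (a : AlgA q) : ∃ b, a = killX q a + b * genX q := by
  obtain ⟨k, l, m, n, rfl⟩ := exists_coords a
  exact ⟨m • 1 + n • genT q, by simp [-zsmul_eq_mul, -zsmul_one, add_mul, add_assoc]⟩

end Algebra

section TensorPower

/-- The tensor power `A^{⊗ n}` behind a definition, so that its ring structure is found along one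
path only. -/
def PowA (q n : ℕ) : Type := ⨂[ℤ] (_ : Fin n), AlgA q

instance (q n : ℕ) : Ring (PowA q n) := inferInstanceAs (Ring (⨂[ℤ] (_ : Fin n), AlgA q))

variable {q n : ℕ}

/-- The pure tensor with components `a i`. -/
def ptensor (a : Fin n → AlgA q) : PowA q n := PiTensorProduct.tprod ℤ a

lemma ptensor_mul (a b : Fin n → AlgA q) : ptensor a * ptensor b = ptensor (a * b) :=
  PiTensorProduct.tprod_mul_tprod a b

lemma ptensor_one : ptensor (1 : Fin n → AlgA q) = 1 := rfl

lemma ptensor_eq_zero {a : Fin n → AlgA q} (i : Fin n) (h : a i = 0) : ptensor a = 0 :=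
  (PiTensorProduct.tprod ℤ).map_coord_zero i h

lemma ptensor_update_add (a : Fin n → AlgA q) (i : Fin n) (b c : AlgA q) :
    ptensor (Function.update a i (b + c)) =
      ptensor (Function.update a i b) + ptensor (Function.update a i c) :=
  (PiTensorProduct.tprod ℤ).map_update_add a i b c

lemma PowA_induction {P : PowA q n → Prop} (hpure : ∀ (m : ℤ) a, P (m • ptensor a))
    (hadd : ∀ y z, P y → P z → P (y + z)) (y : PowA q n) : P y :=
  PiTensorProduct.induction_on (motive := P) y hpure hadd

/-- The `i`-th inclusion `A → A^{⊗ n}`. -/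
def incl (i : Fin n) : AlgA q →+* PowA q n :=
  (PiTensorProduct.singleAlgHom (R := ℤ) (A := fun _ : Fin n ↦ AlgA q) i).toRingHom

lemma incl_apply (i : Fin n) (a : AlgA q) : incl i a = ptensor fun j ↦ if j = i then a else 1 := by
  refine congrArg ptensor (funext fun j ↦ ?_)
  simp [Pi.mulSingle_apply]

lemma incl_genX_mul_mul_incl_genX (d : Fin n) (y : PowA q n) :
    incl d (genX q) * y * incl d (genX q) = 0 := by
  induction y using PowA_induction with
  | hpure m a =>
    rw [mul_smul_comm, smul_mul_assoc, incl_apply, ptensor_mul, ptensor_mul,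
      ptensor_eq_zero d (by simp [genX_mul_mul_genX]), smul_zero]
  | hadd y z hy hz => rw [mul_add, add_mul, hy, hz, add_zero]

lemma incl_genT_mul_mul_incl_genX (d : Fin n) (y : PowA q n) :
    incl d (genT q) * y * incl d (genX q) = y * incl d (genT q) * incl d (genX q) := by
  induction y using PowA_induction with
  | hpure m a =>
    simp only [mul_smul_comm, smul_mul_assoc, incl_apply, ptensor_mul]
    congr 2
    ext j
    by_cases h : j = d <;> simp [h, genT_mul_mul_genX]
  | hadd y z hy hz => rw [mul_add, add_mul, hy, hz, add_mul, add_mul]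

/-- The multilinear map underlying `killXs`. -/
def killXsMultilinear (S : Finset (Fin n)) :
    MultilinearMap ℤ (fun _ : Fin n ↦ AlgA q) (⨂[ℤ] (_ : Fin n), AlgA q) :=
  (PiTensorProduct.tprod ℤ).compLinearMap fun i ↦
    (if i ∈ S then killX q else RingHom.id _).toAddMonoidHom.toIntLinearMap

lemma killXsMultilinear_apply (S : Finset (Fin n)) (a : Fin n → AlgA q) :
    killXsMultilinear S a =
      PiTensorProduct.tprod ℤ fun i ↦ if i ∈ S then killX q (a i) else a i := by
  refine congrArg (PiTensorProduct.tprod ℤ) (funext fun i ↦ ?_)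
  change (if i ∈ S then killX q else RingHom.id _) (a i) = _
  split_ifs <;> rfl

/-- The endomorphism of `A^{⊗ n}` killing `x_i` for `i ∈ S` and fixing the other generators. -/
def killXs (S : Finset (Fin n)) : PowA q n →+* PowA q n :=
  (PiTensorProduct.liftAlgHom (killXsMultilinear S)
    (by simp [killXsMultilinear_apply, PiTensorProduct.one_def, Pi.one_def])
    (fun a b ↦ by
      simp only [killXsMultilinear_apply, PiTensorProduct.tprod_mul_tprod]
      congr 1
      ext i
      by_cases h : i ∈ S <;> simp [h])).toRingHom

lemma killXs_ptensor (S : Finset (Fin n)) (a : Fin n → AlgA q) :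
    killXs S (ptensor a) = ptensor fun i ↦ if i ∈ S then killX q (a i) else a i :=
  (PiTensorProduct.lift.tprod (φ := killXsMultilinear S) a).trans (killXsMultilinear_apply S a)

lemma commute_incl_genT_killXs (d : Fin n) (y : PowA q n) :
    Commute (incl d (genT q)) (killXs {d} y) := by
  induction y using PowA_induction with
  | hpure m a =>
    rw [map_zsmul, killXs_ptensor, incl_apply]
    rw [commute_iff_eq, mul_smul_comm, smul_mul_assoc, ptensor_mul, ptensor_mul]
    congr 2
    ext j
    by_cases h : j = d <;> simp [h, (commute_genT_killX _).eq]
  | hadd y z hy hz => simpa using hy.add_right hz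

lemma exists_eq_killXs_add (d : Fin n) (y : PowA q n) :
    ∃ z, y = killXs {d} y + z * incl d (genX q) := by
  induction y using PowA_induction with
  | hpure m a =>
    obtain ⟨b, hb⟩ := exists_eq_killX_add (a d)
    refine ⟨m • ptensor (Function.update a d b), ?_⟩
    rw [map_zsmul, killXs_ptensor, incl_apply, smul_mul_assoc, ptensor_mul, ← smul_add]
    congr 1
    calc ptensor a = ptensor (Function.update a d (killX q (a d) + b * genX q)) := by simp [← hb]
      _ = _ := by
        rw [ptensor_update_add]
        clear hb
        congr 2 <;> ext j <;> rcases eq_or_ne j d with rfl | h <;> simp [*]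
  | hadd y z hy hz =>
    obtain ⟨u, hu⟩ := hy
    obtain ⟨v, hv⟩ := hz
    refine ⟨u + v, ?_⟩
    rw [map_add, add_mul, add_add_add_comm, ← hu, ← hv]

lemma killXs_empty (y : PowA q n) : killXs ∅ y = y := by
  induction y using PowA_induction with
  | hpure m a => simp [killXs_ptensor]
  | hadd y z hy hz => rw [map_add, hy, hz]

lemma killXs_insert {d : Fin n} {S : Finset (Fin n)} (h : d ∉ S) (y : PowA q n) :
    killXs (insert d S) y = killXs {d} (killXs S y) := by
  induction y using PowA_induction with
  | hpure m a =>
    simp only [map_zsmul, killXs_ptensor]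
    congr 2
    ext j
    by_cases hj : j = d
    · subst hj; simp [h]
    · simp [hj]
  | hadd y z hy hz => rw [map_add, map_add, map_add, hy, hz]

lemma isNilpotent_of_killXs_singleton {d : Fin n} {y : PowA q n}
    (h : IsNilpotent (killXs {d} y)) : IsNilpotent y := by
  obtain ⟨k, hk⟩ := h
  obtain ⟨z, hz⟩ := exists_eq_killXs_add d (y ^ k)
  rw [map_pow, hk, zero_add] at hz
  refine ⟨k + k, ?_⟩
  rw [pow_add, hz, mul_assoc, ← mul_assoc (incl d _), incl_genX_mul_mul_incl_genX, mul_zero]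

lemma isNilpotent_of_killXs {S : Finset (Fin n)} {y : PowA q n}
    (h : IsNilpotent (killXs S y)) : IsNilpotent y := by
  induction S using Finset.induction with
  | empty => rwa [killXs_empty] at h
  | insert d S hd ih =>
    rw [killXs_insert hd] at h
    exact ih (isNilpotent_of_killXs_singleton h)

lemma exists_eq_sum_ptensor (y : PowA q n) :
    ∃ c : (Fin n → Fin 4) → ℤ, y = ∑ p, c p • ptensor fun i ↦ basisA q (p i) := by
  let b := Basis.piTensorProduct fun _ : Fin n ↦ basisA q
  refine ⟨b.repr y, (b.sum_repr y).symm.trans (Finset.sum_congr rfl fun p _ ↦ ?_)⟩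
  exact congrArg (_ • ·) (Basis.piTensorProduct_apply _ p)

lemma eq_zero_of_zsmul_eq_zero {m : ℤ} (hm : m ≠ 0) {y : PowA q n} (h : m • y = 0) : y = 0 := by
  let b := Basis.piTensorProduct fun _ : Fin n ↦ basisA q
  refine b.ext_elem (x := y) (y := 0) fun p ↦ ?_
  have h' : m • b.repr y = 0 :=
    (map_zsmul b.repr m y).symm.trans ((congrArg b.repr h).trans (map_zero _))
  simpa [hm] using DFunLike.congr_fun h' p

/-- The weights with `coord₀ (b i * b j) = if i = j then weight q i else 0` for the basis `b`. -/
def weight (q : ℕ) : Fin 4 → ℤ := ![1, q, 0, 0]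

lemma basisA_coord_zero_mul (i j : Fin 4) :
    (basisA q).coord 0 (basisA q i * basisA q j) = if i = j then weight q i else 0 := by
  have h (k : Fin 4) : (basisA q).coord 0 (basisA q k) = if k = 0 then 1 else 0 := by
    simp [Finsupp.single_apply]
  have h0 := h 0
  have h1 := h 1
  have h2 := h 2
  have h3 := h 3
  simp only [basisA_apply] at h0 h1 h2 h3 ⊢
  have htt : genT q * genT q = (q : ℤ) • 1 := by simpa using genT_mul_genT_mul q 1
  fin_cases i <;> fin_cases j <;>
    simp_all [-zsmul_eq_mul, -zsmul_one, -natCast_zsmul, weight, mul_assoc, genX_mul_genT,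
      genT_mul_genT_mul, genX_mul_genT_mul, genX_mul_genX]

/-- The coefficient of `1` of an element of `A^{⊗ n}`. -/
def constCoeff : PowA q n →+ ℤ :=
  (PiTensorProduct.lift ((MultilinearMap.mkPiAlgebra ℤ (Fin n) ℤ).compLinearMap
    fun _ ↦ (basisA q).coord 0)).toAddMonoidHom

lemma constCoeff_ptensor (a : Fin n → AlgA q) :
    constCoeff (ptensor a) = ∏ i, (basisA q).coord 0 (a i) :=
  (PiTensorProduct.lift.tprod a).trans (by simp)

lemma constCoeff_natCast (m : ℕ) : constCoeff (m : PowA q n) = m := by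
  have h : constCoeff (1 : PowA q n) = 1 := by
    rw [← ptensor_one, constCoeff_ptensor]
    refine Finset.prod_eq_one fun i _ ↦ ?_
    have : (1 : AlgA q) = basisA q 0 := by simp [basisA_apply]
    simp [this]
  rw [← nsmul_one, map_nsmul, h, nsmul_one]

lemma constCoeff_mul_self (c : (Fin n → Fin 4) → ℤ) :
    constCoeff ((∑ p, c p • ptensor fun i ↦ basisA q (p i)) *
      ∑ p, c p • ptensor fun i ↦ basisA q (p i)) = ∑ p, c p ^ 2 * ∏ i, weight q (p i) := by
  simp only [Finset.sum_mul_sum, map_sum, smul_mul_assoc, mul_smul_comm, map_zsmul, ptensor_mul,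
    constCoeff_ptensor, Pi.mul_apply, basisA_coord_zero_mul]
  refine Finset.sum_congr rfl fun p _ ↦ ?_
  rw [Finset.sum_eq_single p]
  · simp [pow_two, mul_assoc]
  · intro p' _ hne
    obtain ⟨i, hi⟩ := Function.ne_iff.mp hne.symm
    rw [Finset.prod_eq_zero (Finset.mem_univ i) (if_neg hi)]
    simp
  · simp

lemma weight_nonneg (i : Fin 4) : 0 ≤ weight q i := by
  fin_cases i <;> simp [weight]

lemma prod_weight_single (d : Fin n) : ∏ i, weight q (Pi.single (M := fun _ ↦ Fin 4) d 1 i) = q := by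
  rw [Finset.prod_eq_single d]
  · simp [weight]
  · intro i _ hi
    simp [hi, weight]
  · simp

lemma sq_le_prod_weight {p : Fin n → Fin 4} (h : ∏ i, weight q (p i) ≠ 0) (h0 : p ≠ 0)
    (hs : ∀ d, p ≠ Pi.single d 1) : (q : ℤ) ^ 2 ≤ ∏ i, weight q (p i) := by
  have hp (i : Fin n) (hi : p i ≠ 0) : p i = 1 := by
    have := Finset.prod_ne_zero_iff.mp h i (Finset.mem_univ i)
    revert hi this
    generalize p i = k
    fin_cases k <;> simp [weight]
  obtain ⟨i, hi⟩ := Function.ne_iff.mp h0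
  replace hi := hp i hi
  obtain ⟨j, hj⟩ := Function.ne_iff.mp (hs i)
  have hji : j ≠ i := by
    rintro rfl
    simp [hi] at hj
  rw [Pi.single_eq_of_ne hji] at hj
  replace hj := hp j hj
  refine Int.le_of_dvd ((Finset.prod_nonneg fun i _ ↦ weight_nonneg _).lt_of_ne' h) ?_
  have := Finset.prod_dvd_prod_of_subset {i, j} Finset.univ (fun i ↦ weight q (p i))
    (Finset.subset_univ _)
  rwa [Finset.prod_pair hji.symm, hi, hj, ← pow_two] at this

lemma eq_single_of_sum_sq_mul_weight (hq : ¬ IsSquare q) {c : (Fin n → Fin 4) → ℤ}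
    (hc : ∑ p, c p ^ 2 * ∏ i, weight q (p i) = q) :
    ∃ (d : Fin n) (s : ℤ), (s = 1 ∨ s = -1) ∧ c (Pi.single d 1) = s ∧
      ∀ p, p ≠ Pi.single d 1 → ∏ i, weight q (p i) ≠ 0 → c p = 0 := by
  have hq2 : 2 ≤ q := by
    by_contra! h
    interval_cases q <;> simp at hq
  have hw (p : Fin n → Fin 4) : 0 ≤ ∏ i, weight q (p i) :=
    Finset.prod_nonneg fun i _ ↦ weight_nonneg _
  have hnonneg (p : Fin n → Fin 4) : 0 ≤ c p ^ 2 * ∏ i, weight q (p i) :=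
    mul_nonneg (sq_nonneg _) (hw p)
  have hone {m : ℤ} (hm : m ≠ 0) : 1 ≤ m ^ 2 := by
    have := sq_pos_of_ne_zero hm
    omega
  by_cases hd : ∃ d, c (Pi.single d 1) ≠ 0
  · obtain ⟨d, hd⟩ := hd
    rw [← Finset.add_sum_erase _ _ (Finset.mem_univ (Pi.single d 1)), prod_weight_single] at hc
    have hrest := Finset.sum_nonneg fun p (_ : p ∈ Finset.univ.erase (Pi.single d 1)) ↦ hnonneg p
    have hsq : c (Pi.single d 1) ^ 2 = 1 := by
      have := hone hd
      nlinarith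
    refine ⟨d, _, mul_self_eq_one_iff.mp (by rw [← pow_two, hsq]), rfl, fun p hp hwp ↦ ?_⟩
    rw [hsq, one_mul, add_eq_left, Finset.sum_eq_zero_iff_of_nonneg fun p _ ↦ hnonneg p] at hc
    simpa [hwp] using hc p (by simp [hp])
  · push Not at hd
    refine absurd ?_ hq
    rw [Finset.sum_eq_single 0] at hc
    · refine ⟨(c 0).natAbs, ?_⟩
      zify
      simpa [weight, pow_two] using hc.symm
    · intro p _ hp0
      by_contra hp
      have hwp := right_ne_zero_of_mul hp
      have hcp := hone (ne_zero_pow two_ne_zero (left_ne_zero_of_mul hp))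
      have hle := sq_le_prod_weight hwp hp0 (by rintro d rfl; simp [hd] at hp)
      have := Finset.single_le_sum (fun p _ ↦ hnonneg p) (Finset.mem_univ p)
      rw [hc] at this
      nlinarith
    · simp

lemma killXs_univ_ptensor_basisA (hq : q ≠ 0) {p : Fin n → Fin 4} (h : ∏ i, weight q (p i) = 0) :
    killXs Finset.univ (ptensor fun i ↦ basisA q (p i)) = 0 := by
  obtain ⟨i, -, hi⟩ := Finset.prod_eq_zero_iff.mp h
  rw [killXs_ptensor]
  refine ptensor_eq_zero i ?_
  rw [if_pos (Finset.mem_univ i), basisA_apply]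
  revert hi
  generalize p i = k
  fin_cases k <;> simp [weight, hq]

lemma killXs_incl_genT (S : Finset (Fin n)) (d : Fin n) :
    killXs S (incl d (genT q)) = incl d (genT q) := by
  rw [incl_apply, killXs_ptensor]
  congr 1
  ext j
  by_cases h : j = d <;> simp [h]

lemma killXs_incl_genX (d : Fin n) : killXs {d} (incl d (genX q)) = 0 := by
  rw [incl_apply, killXs_ptensor]
  exact ptensor_eq_zero d (by simp)

/-- Modulo the `x_i`, the only square roots of `q` are the `± t_d`. -/
lemma exists_killXs_univ_eq (hq : ¬ IsSquare q) {y : PowA q n} (hy : y * y = q) :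
    ∃ (d : Fin n) (s : ℤ), (s = 1 ∨ s = -1) ∧ killXs Finset.univ y = s • incl d (genT q) := by
  have hq0 : q ≠ 0 := by rintro rfl; simp at hq
  obtain ⟨c, rfl⟩ := exists_eq_sum_ptensor y
  have hc := constCoeff_mul_self (q := q) c
  rw [hy, constCoeff_natCast] at hc
  obtain ⟨d, s, hs, hcd, hc⟩ := eq_single_of_sum_sq_mul_weight hq hc.symm
  refine ⟨d, s, hs, ?_⟩
  rw [map_sum, Finset.sum_eq_single (Pi.single d 1)]
  · rw [map_zsmul, hcd, ← killXs_incl_genT Finset.univ, incl_apply]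
    congr 3
    ext j
    rcases eq_or_ne j d with rfl | h <;> simp [basisA_apply, *]
  · intro p _ hp
    rw [map_zsmul]
    by_cases hw : ∏ i, weight q (p i) = 0
    · rw [killXs_univ_ptensor_basisA hq0 hw, smul_zero]
    · rw [hc p hp hw, zero_smul]
  · simp

lemma eq_zero_of_incl_genT_mul (hq : q ≠ 0) {d : Fin n} {y : PowA q n} {m : ℤ} (hm : m ≠ 0)
    (h : m • (incl d (genT q) * y) = 0) : y = 0 := by
  refine eq_zero_of_zsmul_eq_zero (m := m * q) (mul_ne_zero hm (by exact_mod_cast hq)) ?_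
  have := congrArg (incl d (genT q) * ·) h
  simpa [-zsmul_eq_mul, mul_smul_comm, ← mul_assoc, ← map_mul, genT_mul_genT, mul_smul] using this

lemma eq_zero_of_isNilpotent (hq : q ≠ 0) {d : Fin n} {y : PowA q n} {m : ℤ} (hm : m ≠ 0)
    (hy : IsNilpotent y) (h : y * y = m • (incl d (genT q) * y)) : y = 0 := by
  obtain ⟨k, hk⟩ := hy
  induction k with
  | zero => simpa using congrArg (· * y) hk
  | succ k ih =>
    cases k with
    | zero => simpa using hk
    | succ k =>
      refine ih (eq_zero_of_incl_genT_mul hq hm (d := d) ?_)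
      rw [pow_succ', pow_succ', ← mul_assoc, h] at hk
      simpa only [smul_mul_assoc, mul_assoc, pow_succ'] using hk

/-- A square root of `q` in `A^{⊗ n}` is `± t_d + f x_d`. -/
lemma exists_eq_of_mul_self_eq (hq : ¬ IsSquare q) {y : PowA q n} (hy : y * y = q) :
    ∃ (d : Fin n) (s : ℤ), (s = 1 ∨ s = -1) ∧
      killXs {d} y = s • incl d (genT q) ∧ ∃ f, y = s • incl d (genT q) + f * incl d (genX q) := by
  have hq0 : q ≠ 0 := by rintro rfl; simp at hq
  obtain ⟨d, s, hs, hd⟩ := exists_killXs_univ_eq hq hy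
  have hs0 : s ≠ 0 := by rcases hs with rfl | rfl <;> simp
  have hss : s * s = 1 := by rcases hs with rfl | rfl <;> simp
  have hnil : IsNilpotent (y - s • incl d (genT q)) :=
    isNilpotent_of_killXs (S := Finset.univ) (by simp [-zsmul_eq_mul, hd, killXs_incl_genT])
  have key : killXs {d} (y - s • incl d (genT q)) = 0 := by
    set h := killXs {d} (y - s • incl d (genT q)) with hh
    refine eq_zero_of_isNilpotent hq0 (m := -2 * s) (by simpa using hs0)
      (hnil.map (killXs {d})) (d := d) ?_
    have hyh : killXs {d} y = s • incl d (genT q) + h := by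
      rw [hh, map_sub, map_zsmul, killXs_incl_genT]
      abel
    have hcomm : incl d (genT q) * h = h * incl d (genT q) := commute_incl_genT_killXs d _
    have htt : incl d (genT q) * incl d (genT q) = (q : PowA q n) := by
      rw [← map_mul, genT_mul_genT, map_natCast]
    have := congrArg (killXs {d}) hy
    rw [map_mul, hyh, map_natCast] at this
    simp only [mul_add, add_mul, mul_smul_comm, smul_mul_assoc, smul_add, smul_smul, hss, one_smul, htt,
      ← hcomm] at this
    rw [add_assoc, add_eq_left] at this
    rw [← sub_eq_zero, ← this]
    module
  rw [map_sub, map_zsmul, killXs_incl_genT, sub_eq_zero] at key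
  obtain ⟨f, hf⟩ := exists_eq_killXs_add d y
  exact ⟨d, s, hs, key, f, by rw [← key, ← hf]⟩

theorem exists_of_ringHom (hq : ¬ IsSquare q) (Ψ : AlgA q →+* PowA q n) :
    ∃ (d : Fin n) (s : ℤ), (s = 1 ∨ s = -1) ∧ ∃ f g : PowA q n,
      Ψ (genT q) = s • incl d (genT q) + f * incl d (genX q) ∧
      Ψ (genX q) = g * incl d (genX q) := by
  have hq0 : q ≠ 0 := by rintro rfl; simp at hq
  obtain ⟨d, s, hs, hd, f, hf⟩ := exists_eq_of_mul_self_eq (y := Ψ (genT q)) hq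
    (by rw [← map_mul, genT_mul_genT, map_natCast])
  have hs0 : s ≠ 0 := by rcases hs with rfl | rfl <;> simp
  obtain ⟨g, hg⟩ := exists_eq_killXs_add d (Ψ (genX q))
  refine ⟨d, s, hs, f, g, hf, ?_⟩
  have key : killXs {d} (Ψ (genX q)) = 0 := by
    refine eq_zero_of_incl_genT_mul hq0 (m := 2 * s) (by simpa using hs0) (d := d) ?_
    have := congrArg (fun a ↦ killXs {d} (Ψ a)) (genT_mul_genX q)
    simp only [map_mul, map_neg, hd, smul_mul_assoc, mul_smul_comm,
      ← (commute_incl_genT_killXs d _).eq] at this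
    rw [← sub_eq_zero] at this
    rw [← this]
    module
  rwa [key, zero_add] at hg

section Extension

variable (d : Fin n) {s : ℤ} (f g : PowA q n)

lemma mul_incl_genX_mul_mul_incl_genX : f * incl d (genX q) * (g * incl d (genX q)) = 0 := by
  rw [mul_assoc, ← mul_assoc (incl d _), incl_genX_mul_mul_incl_genX, mul_zero]

lemma incl_genT_mul_mul_incl_genX_eq_neg :
    incl d (genT q) * (f * incl d (genX q)) = -(f * incl d (genX q) * incl d (genT q)) := by
  rw [← mul_assoc, incl_genT_mul_mul_incl_genX, mul_assoc, mul_assoc, ← map_mul, ← map_mul,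
    genT_mul_genX, map_neg, mul_neg]

/-- The ring homomorphism with `t ↦ s t_d + f x_d` and `x ↦ g x_d`. -/
def extend (hs : s = 1 ∨ s = -1) : AlgA q →+* PowA q n :=
  liftAlgA (s • incl d (genT q) + f * incl d (genX q)) (g * incl d (genX q))
    (by
      have hss : s * s = 1 := by rcases hs with rfl | rfl <;> simp
      simp only [mul_add, add_mul, mul_smul_comm, smul_mul_assoc, smul_add, smul_smul, hss, one_smul,
        mul_incl_genX_mul_mul_incl_genX, incl_genT_mul_mul_incl_genX_eq_neg]
      rw [← map_mul, genT_mul_genT, map_natCast]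
      module)
    (by
      simp only [mul_add, add_mul, mul_smul_comm, smul_mul_assoc,
        mul_incl_genX_mul_mul_incl_genX, incl_genT_mul_mul_incl_genX_eq_neg]
      module)
    (mul_incl_genX_mul_mul_incl_genX d g g)

variable {d f g} in
lemma map_genT_mul_genX {Ψ : AlgA q →+* PowA q n}
    (ht : Ψ (genT q) = s • incl d (genT q) + f * incl d (genX q))
    (hx : Ψ (genX q) = g * incl d (genX q)) :
    Ψ (genT q * genX q) = s • (g * (incl d (genT q) * incl d (genX q))) := by
  rw [map_mul, ht, hx, add_mul, mul_incl_genX_mul_mul_incl_genX, add_zero, smul_mul_assoc,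
    ← mul_assoc, incl_genT_mul_mul_incl_genX, mul_assoc]

theorem existsUnique_ringHom (hs : s = 1 ∨ s = -1) : ∃! Ψ : AlgA q →+* PowA q n,
    Ψ (genT q) = s • incl d (genT q) + f * incl d (genX q) ∧
      Ψ (genX q) = g * incl d (genX q) :=
  ⟨extend d f g hs, ⟨liftAlgA_genT .., liftAlgA_genX ..⟩, fun _ h ↦
    AlgA_hom_ext (h.1.trans (liftAlgA_genT ..).symm) (h.2.trans (liftAlgA_genX ..).symm)⟩

end Extension

lemma tI_eq (d : Fin n) : tI q n d = incl d (genT q) := (incl_apply d (genT q)).symm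

lemma xI_eq (d : Fin n) : xI q n d = incl d (genX q) := (incl_apply d (genX q)).symm

end TensorPower

/-- A map `ψ : A → A^{⊗ n}` is a unital ring homomorphism if and only if there are
`d ∈ {1, …, n}`, a sign `s ∈ {1, −1}` and `f, g ∈ A^{⊗ n}` such that `ψ` is the unique
ring homomorphism with `ψ(t) = s·t_d + f·x_d` and `ψ(x) = g·x_d` (and then
`ψ(t·x) = s·g·t_d·x_d`); conversely every such assignment extends uniquely to a
unital ring homomorphism `A → A^{⊗ n}`. -/
theorem stmt18 (q : ℕ) (hq : ¬ IsSquare q) (n : ℕ) (hn : 1 ≤ n) :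
    (∀ ψ : A q → Tpow q n,
      (∃ Ψ : A q →+* Tpow q n, ⇑Ψ = ψ) ↔
      ∃ (d : Fin n) (s : ℤ), (s = 1 ∨ s = -1) ∧
        ∃ f g : Tpow q n, ∃ Ψ : A q →+* Tpow q n, ⇑Ψ = ψ ∧
          Ψ (tA q) = s • tI q n d + f * xI q n d ∧
          Ψ (xA q) = g * xI q n d ∧
          Ψ (tA q * xA q) = s • (g * (tI q n d * xI q n d)) ∧
          (∀ Ψ' : A q →+* Tpow q n,
            Ψ' (tA q) = s • tI q n d + f * xI q n d →
            Ψ' (xA q) = g * xI q n d → Ψ' = Ψ)) ∧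
    (∀ (d : Fin n) (s : ℤ), (s = 1 ∨ s = -1) → ∀ f g : Tpow q n,
      ∃! Ψ : A q →+* Tpow q n,
        Ψ (tA q) = s • tI q n d + f * xI q n d ∧ Ψ (xA q) = g * xI q n d) := by
  simp only [tI_eq, xI_eq]
  have hex := fun d s hs f g ↦ existsUnique_ringHom (q := q) (n := n) (s := s) d f g hs
  refine ⟨fun ψ ↦ ⟨?_, fun ⟨_, _, _, _, _, Ψ, h, _⟩ ↦ ⟨Ψ, h⟩⟩, hex⟩
  rintro ⟨Ψ, h⟩
  obtain ⟨d, s, hs, f, g, ht, hx⟩ := exists_of_ringHom hq Ψ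
  exact ⟨d, s, hs, f, g, Ψ, h, ht, hx, map_genT_mul_genX ht hx,
    fun Ψ' ht' hx' ↦ (hex d s hs f g).unique ⟨ht', hx'⟩ ⟨ht, hx⟩⟩
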